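/- Let A be an m×n real matrix with nonnegative entries and b ∈ ℝ^m nonnegative, with LIN > 0 the attained optimal value of min{‖x‖₁ : Ax ≥ b, x ≥ 0}. Let δ > 0 and let α be a positive integer. Let x' be feasible with ‖x'‖₁ = (1+δ')·LIN for some δ' ≥ δ and ‖x'‖₁ ≥ 2α·(1/δ + 1). Let C ≥ δ'·LIN and let y' ∈ ℕ^n be an integral feasible solution with ‖y'‖₁ ≤ LIN + 2C, ‖y'‖₁ ≥ (m+2)·(1/δ + 2), and y'_i ≥ x'_i for all i. Assume x' and y' have exactly the same set of nonzero components, of cardinality K ≤ C. Then there exist a feasible x'' and an integral feasible y'' ∈ ℕ^n such that: ‖x''‖₁ ≤ ‖x'‖₁ − α = (1+δ')·LIN − α; either ‖y''‖₁ ≤ ‖y'‖₁ − α or ‖y''‖₁ ≤ ‖x'‖₁ − α + C; x'' and y'' have the same set of nonzero components, of cardinality at most C; x''_i ≤ y''_i for all i; and ‖y'' − y'‖₁ ≤ 2(m+2)·(1/δ + 2) + 4α·(1/δ + 2) + m + 2. -/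

import Mathlib

open Finset

lemma aux_small {ι : Type*} [DecidableEq ι] (w : ι → ℝ) (k : ℕ) :
    ∀ (N : ℕ) (T : Finset ι), T.card = N → k ≤ N →
      ∃ S ⊆ T, S.card = k ∧ (N : ℝ) * ∑ j ∈ S, w j ≤ k * ∑ j ∈ T, w j := by
  intro N
  induction N with
  | zero =>
    intro T hT hk
    refine ⟨T, Subset.rfl, by omega, ?_⟩
    have : k = 0 := by omega
    subst this
    simp
  | succ N ih =>
    intro T hT hk
    rcases Nat.lt_or_ge N k with h | h
    · have : k = N + 1 := by omega
      exact ⟨T, Subset.rfl, by omega, by rw [this]⟩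
    · have hne : T.Nonempty := by
        rw [← Finset.card_pos]; omega
      obtain ⟨j, hj, hmax⟩ := Finset.exists_max_image T w hne
      obtain ⟨S, hS, hSc, hSs⟩ := ih (T.erase j) (by rw [Finset.card_erase_of_mem hj]; omega) h
      refine ⟨S, hS.trans (Finset.erase_subset _ _), hSc, ?_⟩
      have hsum : ∑ i ∈ T, w i = w j + ∑ i ∈ T.erase j, w i := (Finset.add_sum_erase T w hj).symm
      have hSle : ∑ i ∈ S, w i ≤ k * w j := by
        have := Finset.sum_le_card_nsmul S w (w j)
          (fun i hi => hmax i (Finset.mem_of_mem_erase (hS hi)))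
        rw [hSc, nsmul_eq_mul] at this
        exact this
      rw [hsum]
      push_cast
      nlinarith

lemma aux_basic {m n : ℕ} (A : Matrix (Fin m) (Fin n) ℝ) (b : Fin m → ℝ) :
    ∀ (N : ℕ) (z : Fin n → ℝ), (∀ j, 0 ≤ z j) → (∀ i, b i ≤ A.mulVec z i) →
      (Finset.univ.filter (fun j => z j ≠ 0)).card ≤ N →
      ∃ z' : Fin n → ℝ, (∀ j, 0 ≤ z' j) ∧ (∀ i, b i ≤ A.mulVec z' i) ∧
        ∑ j, z' j ≤ ∑ j, z j ∧ (Finset.univ.filter (fun j => z' j ≠ 0)).card ≤ m := by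
  intro N
  induction N with
  | zero =>
    intro z h0 hf hc
    exact ⟨z, h0, hf, le_rfl, by omega⟩
  | succ N ih =>
    intro z h0 hf hc
    set T := Finset.univ.filter (fun j => z j ≠ 0) with hT
    rcases Nat.lt_or_ge m T.card with h | h
    swap
    · exact ⟨z, h0, hf, le_rfl, h⟩
    -- a direction
    have key : ∃ d : Fin n → ℝ, (∀ j, j ∉ T → d j = 0) ∧ A.mulVec d = 0 ∧ (∃ j, d j ≠ 0) := by
      have hnot : ¬ LinearIndependent ℝ (fun j : T => (fun i => A i j : Fin m → ℝ)) := by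
        intro hl
        have := hl.fintype_card_le_finrank
        simp at this
        omega
      rw [Fintype.not_linearIndependent_iff] at hnot
      obtain ⟨g, hg, j, hj⟩ := hnot
      refine ⟨fun j => if hj : j ∈ T then g ⟨j, hj⟩ else 0, ?_, ?_, ?_⟩
      · intro j hj; simp [hj]
      · ext i
        have := congrFun hg i
        simp only [Finset.sum_apply, Pi.smul_apply, smul_eq_mul, Pi.zero_apply] at this
        simp only [Matrix.mulVec, dotProduct, Pi.zero_apply]
        refine Eq.trans ?_ this
        rw [← Finset.sum_subset (Finset.subset_univ T), ← Finset.sum_coe_sort T]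
        · apply Finset.sum_congr rfl
          intro x _
          simp [mul_comm]
        · intro x _ hx; simp [hx]
      · refine ⟨j.1, ?_⟩
        simpa using hj
    have key2 : ∃ d : Fin n → ℝ, (∀ j, j ∉ T → d j = 0) ∧ A.mulVec d = 0 ∧ (∃ j, d j ≠ 0) ∧
        ∑ j, d j ≤ 0 := by
      obtain ⟨d, h1, h2, j, h3⟩ := key
      rcases le_total (∑ j, d j) 0 with h | h
      · exact ⟨d, h1, h2, ⟨j, h3⟩, h⟩
      · refine ⟨-d, fun j hj => by simp [h1 j hj], by rw [Matrix.mulVec_neg, h2, neg_zero],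
          ⟨j, by simpa using h3⟩, by simpa using h⟩
    obtain ⟨d, hd1, hd2, ⟨j0, hj0⟩, hd4⟩ := key2
    have hneg : ∃ j, d j < 0 := by
      by_contra hcon
      push Not at hcon
      have : ∑ j, d j = 0 := le_antisymm hd4 (Finset.sum_nonneg fun j _ => hcon j)
      rw [Finset.sum_eq_zero_iff_of_nonneg (fun j _ => hcon j)] at this
      exact hj0 (this j0 (Finset.mem_univ _))
    obtain ⟨p, hp, hpmin⟩ := Finset.exists_min_image (Finset.univ.filter (fun j => d j < 0))
      (fun j => z j / (- d j)) (by obtain ⟨j, hj⟩ := hneg; exact ⟨j, by simp [hj]⟩)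
    have hdp : d p < 0 := by simpa using hp
    set t := z p / (- d p) with ht
    have ht0 : 0 ≤ t := div_nonneg (h0 p) (by linarith)
    have hpT : p ∈ T := by
      by_contra hcon
      have := hd1 p hcon
      linarith
    have g1 : ∀ j, 0 ≤ (z + t • d) j := by
      intro j
      simp only [Pi.add_apply, Pi.smul_apply, smul_eq_mul]
      rcases le_or_gt 0 (d j) with hj | hj
      · have := h0 j
        positivity
      · have h := hpmin j (by simp [hj])
        have h' : t * (- d j) ≤ z j := by
          rwa [le_div_iff₀ (by linarith)] at h
        linarith
    have g2 : ∀ i, b i ≤ A.mulVec (z + t • d) i := by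
      intro i
      rw [Matrix.mulVec_add, Matrix.mulVec_smul, hd2]
      simpa using hf i
    have g3 : (Finset.univ.filter (fun j => (z + t • d) j ≠ 0)).card ≤ N := by
      have hsub : Finset.univ.filter (fun j => (z + t • d) j ≠ 0) ⊆ T.erase p := by
        intro j hj
        simp only [Finset.mem_filter, Finset.mem_univ, true_and, Pi.add_apply, Pi.smul_apply,
          smul_eq_mul] at hj
        rw [Finset.mem_erase]
        constructor
        · rintro rfl
          apply hj
          have hne : d j ≠ 0 := hdp.ne
          rw [ht, div_neg, neg_mul, div_mul_cancel₀ _ hne, add_neg_cancel]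
        · by_contra hcon
          apply hj
          rw [hd1 j hcon]
          have : z j = 0 := by simpa [hT] using hcon
          simp [this]
      have := Finset.card_le_card hsub
      rw [Finset.card_erase_of_mem hpT] at this
      omega
    obtain ⟨z', a1, a2, a3, a4⟩ := ih (z + t • d) g1 g2 g3
    · refine ⟨z', a1, a2, a3.trans ?_, a4⟩
      simp only [Pi.add_apply, Pi.smul_apply, smul_eq_mul, Finset.sum_add_distrib,
        ← Finset.mul_sum]
      nlinarith

lemma aux_reduce {n : ℕ} (lo hi : Fin n → ℕ) (h : ∀ j, lo j ≤ hi j) (r : ℕ) :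
    ∃ f : Fin n → ℕ, (∀ j, lo j ≤ f j) ∧ (∀ j, f j ≤ hi j) ∧
      (∑ j, f j + r = ∑ j, hi j ∨ f = lo) ∧ ∑ j, hi j ≤ ∑ j, f j + r := by
  induction r with
  | zero => exact ⟨hi, h, fun _ => le_rfl, Or.inl rfl, le_rfl⟩
  | succ r ih =>
    obtain ⟨f, h1, h2, h3, h4⟩ := ih
    by_cases hf : f = lo
    · exact ⟨f, h1, h2, Or.inr hf, by omega⟩
    · have h3' := h3.resolve_right hf
      obtain ⟨p, hp⟩ : ∃ p, f p ≠ lo p := by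
        by_contra hcon
        push Not at hcon
        exact hf (funext hcon)
      have hlt : lo p < f p := lt_of_le_of_ne (h1 p) (Ne.symm hp)
      have hs : ∑ j, (Function.update f p (f p - 1)) j + 1 = ∑ j, f j := by
        rw [Finset.sum_update_of_mem (Finset.mem_univ p), ← Finset.add_sum_erase _ f (Finset.mem_univ p),
          Finset.sdiff_singleton_eq_erase]
        omega
      refine ⟨Function.update f p (f p - 1), ?_, ?_, Or.inl (by omega), by omega⟩
      · intro j
        by_cases hj : j = p
        · subst hj; simp; omega
        · simp [hj, h1 j]
      · intro j
        by_cases hj : j = p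
        · subst hj
          have := h2 j
          simp; omega
        · simp [hj, h2 j]

lemma aux_mono {m n : ℕ} (A : Matrix (Fin m) (Fin n) ℝ) (hA : ∀ i j, 0 ≤ A i j)
    (u v : Fin n → ℝ) (h : ∀ j, u j ≤ v j) (i : Fin m) : A.mulVec u i ≤ A.mulVec v i := by
  simp only [Matrix.mulVec, dotProduct]
  exact Finset.sum_le_sum fun j _ => mul_le_mul_of_nonneg_left (h j) (hA i j)

lemma aux_ceil {n : ℕ} (x : Fin n → ℝ) (hx : ∀ j, 0 ≤ x j) :
    ∑ j, (⌈x j⌉₊ : ℝ) ≤ ∑ j, x j + ((Finset.univ.filter (fun j => x j ≠ 0)).card : ℝ) := by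
  rw [Finset.card_filter]
  push_cast
  rw [← Finset.sum_add_distrib]
  apply Finset.sum_le_sum
  intro j _
  by_cases h : x j = 0
  · simp [h]
  · have := Nat.ceil_lt_add_one (hx j)
    simp [h]
    linarith

set_option maxHeartbeats 1000000 in
theorem algorithm5_decrease
    (m n : ℕ) (hm : 0 < m) (hn : 0 < n)
    (A : Matrix (Fin m) (Fin n) ℝ) (hA : ∀ i j, 0 ≤ A i j)
    (b : Fin m → ℝ) (hb : ∀ i, 0 ≤ b i)
    (xOPT : Fin n → ℝ)
    (hxOPTnonneg : ∀ j, 0 ≤ xOPT j)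
    (hxOPTfeas : ∀ i, b i ≤ A.mulVec xOPT i)
    (hxOPTopt : ∀ x : Fin n → ℝ, (∀ j, 0 ≤ x j) → (∀ i, b i ≤ A.mulVec x i) →
      ∑ j, |xOPT j| ≤ ∑ j, |x j|)
    (LIN : ℝ) (hLIN : LIN = ∑ j, |xOPT j|) (hLINpos : 0 < LIN)
    (δ : ℝ) (hδ : 0 < δ) (α : ℕ) (hα : 0 < α)
    (x' : Fin n → ℝ)
    (hx'nonneg : ∀ j, 0 ≤ x' j)
    (hx'feas : ∀ i, b i ≤ A.mulVec x' i)
    (δ' : ℝ) (hδ' : δ ≤ δ')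
    (hx'val : ∑ j, |x' j| = (1 + δ') * LIN)
    (hx'big : 2 * (α : ℝ) * (1 / δ + 1) ≤ ∑ j, |x' j|)
    (C : ℝ) (hC : δ' * LIN ≤ C)
    (y' : Fin n → ℕ)
    (hy'feas : ∀ i, b i ≤ A.mulVec (fun j => (y' j : ℝ)) i)
    (hy'val : ∑ j, (y' j : ℝ) ≤ LIN + 2 * C)
    (hy'big : ((m : ℝ) + 2) * (1 / δ + 2) ≤ ∑ j, (y' j : ℝ))
    (hy'ge : ∀ j, x' j ≤ (y' j : ℝ))
    (hsupp : ∀ j, x' j ≠ 0 ↔ y' j ≠ 0)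
    (K : ℕ) (hK : (Finset.univ.filter (fun j => y' j ≠ 0)).card = K)
    (hKle : (K : ℝ) ≤ C) :
    ∃ x'' : Fin n → ℝ, ∃ y'' : Fin n → ℕ,
      (∀ j, 0 ≤ x'' j) ∧ (∀ i, b i ≤ A.mulVec x'' i) ∧
      (∀ i, b i ≤ A.mulVec (fun j => (y'' j : ℝ)) i) ∧
      ∑ j, |x'' j| ≤ (∑ j, |x' j|) - α ∧
      (∑ j, |x' j|) - α = (1 + δ') * LIN - α ∧
      (∑ j, (y'' j : ℝ) ≤ (∑ j, (y' j : ℝ)) - α ∨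
        ∑ j, (y'' j : ℝ) ≤ (∑ j, |x' j|) - α + C) ∧
      (∀ j, x'' j ≠ 0 ↔ y'' j ≠ 0) ∧
      ((Finset.univ.filter (fun j => y'' j ≠ 0)).card : ℝ) ≤ C ∧
      (∀ j, x'' j ≤ (y'' j : ℝ)) ∧
      ∑ j, |(y'' j : ℝ) - (y' j : ℝ)| ≤
        2 * ((m : ℝ) + 2) * (1 / δ + 2) + 4 * (α : ℝ) * (1 / δ + 2) + m + 2 := by
  have hδ'0 : 0 < δ' := lt_of_lt_of_le hδ hδ'
  have hα1 : (1 : ℝ) ≤ α := by exact_mod_cast hα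
  set s : ℝ := 1 / δ with hs
  have hs0 : 0 < s := by positivity
  have hss : 1 / δ' ≤ s := one_div_le_one_div_of_le hδ hδ'
  have hsδ : 1 ≤ s * δ' := by
    rwa [div_le_iff₀ hδ'0] at hss
  have hX : ∑ j, |x' j| = ∑ j, x' j := Finset.sum_congr rfl fun j _ => abs_of_nonneg (hx'nonneg j)
  have hO : LIN = ∑ j, xOPT j := by
    rw [hLIN]; exact Finset.sum_congr rfl fun j _ => abs_of_nonneg (hxOPTnonneg j)
  rw [hX] at hx'val hx'big ⊢
  have hDL : 0 < δ' * LIN := by positivity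
  have hLC : LIN ≤ s * C := by
    have h1 : LIN * 1 ≤ LIN * (s * δ') := mul_le_mul_of_nonneg_left hsδ hLINpos.le
    have h2 : s * (δ' * LIN) ≤ s * C := mul_le_mul_of_nonneg_left hC hs0.le
    nlinarith
  have hYC : ∑ j, (y' j : ℝ) ≤ C * (s + 2) := by nlinarith
  have hCm : (m : ℝ) + 2 ≤ C := by
    have : ((m : ℝ) + 2) * (s + 2) ≤ C * (s + 2) := hy'big.trans hYC
    exact le_of_mul_le_mul_right this (by positivity)
  -- c
  have h2α : 2 * (α : ℝ) ≤ δ' * LIN := by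
    have h1 : 2 * (α : ℝ) * (s + 1) * δ' ≤ (1 + δ') * LIN * δ' := by
      rw [← hx'val]; exact mul_le_mul_of_nonneg_right hx'big hδ'0.le
    have h2 : 2 * (α : ℝ) * (1 + δ') ≤ 2 * (α : ℝ) * (s + 1) * δ' := by nlinarith
    have h3 : 2 * (α : ℝ) * (1 + δ') ≤ (δ' * LIN) * (1 + δ') := by nlinarith
    exact le_of_mul_le_mul_right h3 (by positivity)
  obtain ⟨c, hc⟩ : ∃ c : ℝ, c = α / (δ' * LIN) := ⟨_, rfl⟩
  have hcD : c * (δ' * LIN) = α := by rw [hc]; field_simp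
  have hc0 : 0 ≤ c := by rw [hc]; positivity
  have hc1 : c ≤ 1 / 2 := by
    rw [hc, div_le_iff₀ hDL]; linarith
  have hcL : c * LIN ≤ α * s := by
    have h1 : c * LIN * 1 ≤ c * LIN * (s * δ') :=
      mul_le_mul_of_nonneg_left hsδ (by positivity)
    nlinarith
  -- S
  set T := Finset.univ.filter (fun j => y' j ≠ 0) with hT
  obtain ⟨k, hk⟩ : ∃ k : ℕ, k = ⌈(K : ℝ) + m - C⌉₊ := ⟨_, rfl⟩
  have hk1 : (K : ℝ) + m - C ≤ k := by rw [hk]; exact Nat.le_ceil _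
  have hk2 : k = 0 ∨ (0 < k ∧ (k : ℝ) < (K : ℝ) + m - C + 1) := by
    rcases Nat.eq_zero_or_pos k with h | h
    · exact Or.inl h
    · refine Or.inr ⟨h, ?_⟩
      rw [hk]
      apply Nat.ceil_lt_add_one
      rw [hk] at h
      exact (Nat.ceil_pos.1 h).le
  have hkK : k ≤ K := by
    rcases hk2 with h | ⟨_, h⟩
    · omega
    · have : (k : ℝ) ≤ K := by linarith
      exact_mod_cast this
  obtain ⟨S, hST, hSc, hSs⟩ := aux_small (fun j => x' j + (y' j : ℝ)) k K T hK hkK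
  have hW : ∑ j ∈ T, (x' j + (y' j : ℝ)) ≤ C * (2 * s + 3) := by
    have h1 : ∑ j ∈ T, (x' j + (y' j : ℝ)) ≤ ∑ j, (x' j + (y' j : ℝ)) :=
      Finset.sum_le_sum_of_subset_of_nonneg (Finset.subset_univ _)
        fun j _ _ => add_nonneg (hx'nonneg j) (Nat.cast_nonneg _)
    rw [Finset.sum_add_distrib, Finset.sum_add_distrib] at h1
    rw [Finset.sum_add_distrib]
    nlinarith
  have hQ : ∑ j ∈ S, (x' j + (y' j : ℝ)) ≤ (m + 1) * (2 * s + 3) := by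
    rcases hk2 with h | ⟨h0, h⟩
    · have : S = ∅ := by rw [← Finset.card_eq_zero, hSc, h]
      rw [this, Finset.sum_empty]; positivity
    · have hKpos : (0 : ℝ) < K := by
        have : 0 < K := by omega
        exact_mod_cast this
      have hkKr : (k : ℝ) ≤ K := by exact_mod_cast hkK
      have hkm : (k : ℝ) ≤ m + 1 := by linarith
      have hk0 : (0 : ℝ) ≤ k := Nat.cast_nonneg _
      have h1 : (k : ℝ) * C ≤ (m + 1) * K := by
        have e1 : (k : ℝ) * C ≤ k * (K + m + 1 - k) :=
          mul_le_mul_of_nonneg_left (by linarith) hk0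
        have e2 : 0 ≤ ((m : ℝ) + 1 - k) * (K - k) :=
          mul_nonneg (by linarith) (by linarith)
        nlinarith
      have h2 : (K : ℝ) * ∑ j ∈ S, (x' j + (y' j : ℝ)) ≤ K * ((m + 1) * (2 * s + 3)) := by
        calc _ ≤ (k : ℝ) * ∑ j ∈ T, (x' j + (y' j : ℝ)) := hSs
          _ ≤ k * (C * (2 * s + 3)) := mul_le_mul_of_nonneg_left hW hk0
          _ = (k * C) * (2 * s + 3) := by ring
          _ ≤ ((m + 1) * K) * (2 * s + 3) := mul_le_mul_of_nonneg_right h1 (by positivity)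
          _ = _ := by ring
      exact le_of_mul_le_mul_left h2 hKpos
  rw [Finset.sum_add_distrib] at hQ
  have hxy : ∑ j ∈ S, x' j ≤ ∑ j ∈ S, (y' j : ℝ) := Finset.sum_le_sum fun j _ => hy'ge j
  have hxS0 : 0 ≤ ∑ j ∈ S, x' j := Finset.sum_nonneg fun j _ => hx'nonneg j
  -- fixed part and the basic solution
  obtain ⟨xf, hxf⟩ : ∃ xf : Fin n → ℝ, xf = fun j => if j ∈ S then 0 else (1 - c) * x' j := ⟨_, rfl⟩
  have hxf0 : ∀ j, 0 ≤ xf j := by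
    intro j
    rw [hxf]
    dsimp only
    split_ifs
    · exact le_rfl
    · exact mul_nonneg (by linarith) (hx'nonneg j)
  obtain ⟨z, hz⟩ : ∃ z : Fin n → ℝ,
    z = fun j => c * xOPT j + if j ∈ S then (1 - c) * x' j else 0 := ⟨_, rfl⟩
  have hz0 : ∀ j, 0 ≤ z j := by
    intro j
    rw [hz]
    have h1 := mul_nonneg hc0 (hxOPTnonneg j)
    have h2 : 0 ≤ (1 - c) * x' j := mul_nonneg (by linarith) (hx'nonneg j)
    dsimp only
    split_ifs <;> linarith
  have hzf : xf + z = c • xOPT + (1 - c) • x' := by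
    ext j
    rw [hxf, hz]
    simp only [Pi.add_apply, Pi.smul_apply, smul_eq_mul]
    split_ifs <;> ring
  have hzfeas : ∀ i, (b - A.mulVec xf) i ≤ A.mulVec z i := by
    intro i
    have h1 : A.mulVec xf i + A.mulVec z i = c * A.mulVec xOPT i + (1 - c) * A.mulVec x' i := by
      rw [← Pi.add_apply, ← Matrix.mulVec_add, hzf, Matrix.mulVec_add, Matrix.mulVec_smul,
        Matrix.mulVec_smul]
      rfl
    have h2 := mul_le_mul_of_nonneg_left (hxOPTfeas i) hc0
    have h3 := mul_le_mul_of_nonneg_left (hx'feas i) (by linarith : 0 ≤ 1 - c)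
    rw [Pi.sub_apply]
    linarith
  have hzsum : ∑ j, z j = c * LIN + (1 - c) * ∑ j ∈ S, x' j := by
    rw [hz, Finset.sum_add_distrib, ← Finset.mul_sum, ← hO, Finset.sum_ite_mem, Finset.univ_inter,
      Finset.mul_sum]
  have hxfsum : ∑ j, xf j + ∑ j, z j = c * LIN + (1 - c) * ∑ j, x' j := by
    rw [← Finset.sum_add_distrib, hO, Finset.mul_sum, Finset.mul_sum, ← Finset.sum_add_distrib]
    exact Finset.sum_congr rfl fun j _ => congrFun hzf j
  obtain ⟨u, hu0, hufeas, husum, hucard⟩ := aux_basic A _ _ z hz0 hzfeas le_rfl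
  have husum' : ∑ j, u j ≤ α * s + ∑ j ∈ S, x' j := by
    rw [hzsum] at husum
    nlinarith
  obtain ⟨x'', hx''⟩ : ∃ x'' : Fin n → ℝ, x'' = xf + u := ⟨_, rfl⟩
  have hx''a : ∀ j, x'' j = xf j + u j := fun j => by rw [hx'']; rfl
  have hx''0 : ∀ j, 0 ≤ x'' j := fun j => by rw [hx''a]; exact add_nonneg (hxf0 j) (hu0 j)
  have hx''feas : ∀ i, b i ≤ A.mulVec x'' i := by
    intro i
    have := hufeas i
    rw [hx'', Matrix.mulVec_add]
    simp only [Pi.sub_apply, Pi.add_apply] at this ⊢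
    linarith
  have hx''sum : ∑ j, x'' j ≤ ∑ j, x' j - α := by
    have : ∑ j, x'' j = ∑ j, xf j + ∑ j, u j := by
      rw [← Finset.sum_add_distrib]; exact Finset.sum_congr rfl fun j _ => hx''a j
    rw [this]
    have e1 : c * ∑ j, x' j = c * LIN + c * (δ' * LIN) := by rw [hx'val]; ring
    linarith
  obtain ⟨lo, hlo⟩ : ∃ lo : Fin n → ℕ, lo = fun j => ⌈x'' j⌉₊ := ⟨_, rfl⟩
  obtain ⟨hi, hhi⟩ : ∃ hi : Fin n → ℕ, hi = fun j => max (lo j) (if j ∈ S then 0 else y' j) :=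
    ⟨_, rfl⟩
  have hlohi : ∀ j, lo j ≤ hi j := fun j => by rw [hhi]; exact le_max_left _ _
  obtain ⟨f, hf1, hf2, hf3, hf4⟩ := aux_reduce lo hi hlohi (∑ j, hi j + α - ∑ j, y' j)
  have hfx : ∀ j, x'' j ≤ (f j : ℝ) := by
    intro j
    refine (Nat.le_ceil (x'' j)).trans ?_
    have := hf1 j
    rw [hlo] at this
    exact_mod_cast this
  have hfix : ∀ j, j ∉ S → y' j ≠ 0 → 0 < x'' j := by
    intro j hj hy
    have h1 : 0 < x' j := lt_of_le_of_ne (hx'nonneg j) (Ne.symm ((hsupp j).2 hy))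
    have h2 : 0 < (1 - c) * x' j := mul_pos (by linarith) h1
    have h3 := hu0 j
    rw [hx''a, hxf]
    simp only [hj, if_false]
    linarith
  have hsupp'' : ∀ j, x'' j ≠ 0 ↔ f j ≠ 0 := by
    intro j
    constructor
    · intro h h'
      have := hfx j
      rw [h'] at this
      push_cast at this
      exact h (le_antisymm this (hx''0 j))
    · intro h h'
      have h1 := hf2 j
      have h2 : lo j = 0 := by rw [hlo]; simp [h']
      rw [hhi] at h1
      simp only [h2] at h1
      by_cases hj : j ∈ S
      · simp [hj] at h1; exact h h1
      · simp only [hj, if_false] at h1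
        have : y' j ≠ 0 := by
          intro h3; simp [h3] at h1; exact h h1
        exact (hfix j hj this).ne' h'
  have hcard : ((Finset.univ.filter (fun j => f j ≠ 0)).card : ℝ) ≤ C := by
    have hsub : Finset.univ.filter (fun j => f j ≠ 0) ⊆
        (T \ S) ∪ Finset.univ.filter (fun j => u j ≠ 0) := by
      intro j hj
      simp only [Finset.mem_filter, Finset.mem_univ, true_and] at hj
      have h1 := (hsupp'' j).2 hj
      simp only [Finset.mem_union, Finset.mem_sdiff, Finset.mem_filter, Finset.mem_univ, true_and, hT]
      by_contra hcon
      push Not at hcon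
      obtain ⟨h2, h3⟩ := hcon
      apply h1
      rw [hx''a, h3, hxf]
      by_cases hj : j ∈ S
      · simp [hj]
      · have h5 : y' j = 0 := by
          by_contra h4
          exact hj (h2 h4)
        have h6 : x' j = 0 := by
          by_contra h4
          exact (hsupp j).1 h4 h5
        simp [h6]
    have h1 := (Finset.card_le_card hsub).trans (Finset.card_union_le _ _)
    rw [Finset.card_sdiff_of_subset hST, hK, hSc] at h1
    have h2 : (Finset.univ.filter (fun j => f j ≠ 0)).card + k ≤ K + m := by omega
    have h3 : ((Finset.univ.filter (fun j => f j ≠ 0)).card : ℝ) + k ≤ K + m := by exact_mod_cast h2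
    linarith
  have hcardx : (Finset.univ.filter (fun j => x'' j ≠ 0)).card
      = (Finset.univ.filter (fun j => f j ≠ 0)).card := by
    congr 1
    ext j
    simp only [Finset.mem_filter, Finset.mem_univ, true_and]
    exact hsupp'' j
  have habs : ∑ j, |x'' j| = ∑ j, x'' j :=
    Finset.sum_congr rfl fun j _ => abs_of_nonneg (hx''0 j)
  refine ⟨x'', f, hx''0, hx''feas, ?_, ?_, by rw [hx'val], ?_, hsupp'', hcard, hfx, ?_⟩
  · intro i
    exact (hx''feas i).trans (aux_mono A hA _ _ hfx i)
  · rw [habs]; exact hx''sum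
  · rcases hf3 with h | h
    · left
      have h1 : ∑ j, f j + α ≤ ∑ j, y' j := by omega
      have h2 : (∑ j, (f j : ℝ)) + α ≤ ∑ j, (y' j : ℝ) := by exact_mod_cast h1
      linarith
    · right
      have h1 := aux_ceil x'' hx''0
      rw [hcardx] at h1
      rw [h, hlo]
      linarith
  · -- distance
    obtain ⟨e, he⟩ : ∃ e : Fin n → ℕ, e = fun j => ⌈u j⌉₊ := ⟨_, rfl⟩
    have hE : ∑ j, (e j : ℝ) ≤ α * s + ∑ j ∈ S, x' j + m := by
      have h1 := aux_ceil u hu0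
      have h2 : ((Finset.univ.filter (fun j => u j ≠ 0)).card : ℝ) ≤ m := by exact_mod_cast hucard
      rw [he]
      linarith
    have hhiS : ∀ j, j ∈ S → hi j = e j := by
      intro j hj
      rw [hhi, hlo, he]
      simp [hj, hx''a, hxf]
    have hhiN : ∀ j, j ∉ S → y' j ≤ hi j ∧ hi j ≤ y' j + e j := by
      intro j hj
      rw [hhi]
      simp only [hj, if_false]
      refine ⟨le_max_right _ _, max_le ?_ (Nat.le_add_right _ _)⟩
      rw [hlo, he]
      apply Nat.ceil_le.2
      push_cast
      rw [hx''a, hxf]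
      simp only [hj, if_false]
      have h1 := Nat.le_ceil (u j)
      have h2 := hy'ge j
      have h3 := mul_nonneg hc0 (hx'nonneg j)
      linarith
    have hd1 : ∑ j, |(hi j : ℝ) - y' j| ≤ ∑ j, (e j : ℝ) + ∑ j ∈ S, (y' j : ℝ) := by
      have : ∑ j ∈ S, (y' j : ℝ) = ∑ j, if j ∈ S then (y' j : ℝ) else 0 := by
        rw [Finset.sum_ite_mem, Finset.univ_inter]
      rw [this, ← Finset.sum_add_distrib]
      apply Finset.sum_le_sum
      intro j _
      have e0 : (0 : ℝ) ≤ e j := Nat.cast_nonneg _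
      have y0 : (0 : ℝ) ≤ y' j := Nat.cast_nonneg _
      by_cases hj : j ∈ S
      · rw [hhiS j hj]
        simp only [hj, if_true]
        rw [abs_le]; constructor <;> linarith
      · obtain ⟨h1, h2⟩ := hhiN j hj
        have h1' : (y' j : ℝ) ≤ hi j := by exact_mod_cast h1
        have h2' : (hi j : ℝ) ≤ y' j + e j := by exact_mod_cast h2
        simp only [hj, if_false]
        rw [abs_le]; constructor <;> linarith
    have hd2 : ∑ j, |(hi j : ℝ) - y' j| + (∑ j, (hi j : ℝ) - ∑ j, (y' j : ℝ))
        ≤ 2 * ∑ j, (e j : ℝ) := by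
      rw [← Finset.sum_sub_distrib, ← Finset.sum_add_distrib, Finset.mul_sum]
      apply Finset.sum_le_sum
      intro j _
      have e0 : (0 : ℝ) ≤ e j := Nat.cast_nonneg _
      have y0 : (0 : ℝ) ≤ y' j := Nat.cast_nonneg _
      have h2' : (hi j : ℝ) ≤ y' j + e j := by
        by_cases hj : j ∈ S
        · rw [hhiS j hj]; linarith
        · exact_mod_cast (hhiN j hj).2
      rcases abs_cases ((hi j : ℝ) - y' j) with ⟨h, _⟩ | ⟨h, _⟩ <;> rw [h] <;> linarith
    have hd3 : ∑ j, |(f j : ℝ) - y' j| ≤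
        ∑ j, |(hi j : ℝ) - y' j| + (∑ j, (hi j : ℝ) - ∑ j, (f j : ℝ)) := by
      rw [← Finset.sum_sub_distrib, ← Finset.sum_add_distrib]
      apply Finset.sum_le_sum
      intro j _
      have h1 : (f j : ℝ) ≤ hi j := by exact_mod_cast hf2 j
      have h2 := le_abs_self ((hi j : ℝ) - y' j)
      have h3 := neg_abs_le ((hi j : ℝ) - y' j)
      rw [abs_le]; constructor <;> linarith
    have hαs : 0 ≤ (α : ℝ) * s := by positivity
    have hm0 : (0 : ℝ) ≤ m := Nat.cast_nonneg _
    have hms : 0 ≤ (m : ℝ) * s := by positivity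
    rcases le_total (∑ j, hi j + α) (∑ j, y' j) with h | h
    · have h1 : ∑ j, hi j ≤ ∑ j, f j := by omega
      have h2 : ∑ j, (hi j : ℝ) ≤ ∑ j, (f j : ℝ) := by exact_mod_cast h1
      nlinarith
    · have h1 : ∑ j, hi j + ∑ j, y' j ≤ ∑ j, f j + (∑ j, hi j + α) := by omega
      have h2 : ∑ j, (hi j : ℝ) + ∑ j, (y' j : ℝ) ≤ ∑ j, (f j : ℝ) + (∑ j, (hi j : ℝ) + α) := by
        exact_mod_cast h1
      nlinarith
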